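/- Let 1 < p < ∞. If a weight w on ℝ belongs to A_p^d, then its dual weight w^{-1/(p-1)} belongs to RH_1^d. -/

import Mathlib

open MeasureTheory

noncomputable section

/-- A dyadic interval `[2^{-j} k, 2^{-j}(k+1))`, encoded by its scale `j` and position `k`. -/
structure DyadicInterval where
  j : ℤ
  k : ℤ

namespace DyadicInterval

instance : Countable DyadicInterval :=
  Countable.of_equiv (ℤ × ℤ)
    ⟨fun p => ⟨p.1, p.2⟩, fun I => (I.j, I.k), fun _ => rfl, fun _ => rfl⟩

/-- The underlying set of a dyadic interval. -/
def toSet (I : DyadicInterval) : Set ℝ :=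
  Set.Ico ((2 : ℝ) ^ (-I.j) * (I.k : ℝ)) ((2 : ℝ) ^ (-I.j) * ((I.k : ℝ) + 1))

/-- The length `|I| = 2^{-j}`. -/
def len (I : DyadicInterval) : ℝ := (2 : ℝ) ^ (-I.j)

/-- The left half `I₋` of a dyadic interval. -/
def left (I : DyadicInterval) : DyadicInterval := ⟨I.j + 1, 2 * I.k⟩

/-- The right half `I₊` of a dyadic interval. -/
def right (I : DyadicInterval) : DyadicInterval := ⟨I.j + 1, 2 * I.k + 1⟩

/-- The integral average `⟨f⟩_I = (1/|I|) ∫_I f`. -/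
def avg (I : DyadicInterval) (f : ℝ → ℝ) : ℝ := I.len⁻¹ * ∫ x in I.toSet, f x

/-- `Δ_I f := ⟨f⟩_{I₊} - ⟨f⟩_{I₋}`. -/
def delta (I : DyadicInterval) (f : ℝ → ℝ) : ℝ := avg I.right f - avg I.left f

/-- The Haar function `h_I = |I|^{-1/2} (1_{I₊} - 1_{I₋})`. -/
def haar (I : DyadicInterval) (x : ℝ) : ℝ :=
  (Real.sqrt I.len)⁻¹ *
    (I.right.toSet.indicator (fun _ => (1 : ℝ)) x - I.left.toSet.indicator (fun _ => (1 : ℝ)) x)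

end DyadicInterval

open DyadicInterval

/-- The (unweighted) pairing `⟨f, g⟩ = ∫_ℝ f g`. -/
def ip (f g : ℝ → ℝ) : ℝ := ∫ x, f x * g x

/-- A weight: a.e. positive and locally integrable function on `ℝ`. -/
def IsWeight (w : ℝ → ℝ) : Prop :=
  (∀ᵐ x ∂(volume : Measure ℝ), 0 < w x) ∧ LocallyIntegrable w

/-- A choice of signs `σ = {σ_I}_{I ∈ D}`, `σ_I = ±1`. -/
def IsSigns (σ : DyadicInterval → ℝ) : Prop := ∀ I, σ I = 1 ∨ σ I = -1

/-- The `t`-Haar multiplier `T^t_{w,σ} f = Σ_I σ_I (w/⟨w⟩_I)^t ⟨f,h_I⟩ h_I`. -/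
def tHaar (w : ℝ → ℝ) (t : ℝ) (σ : DyadicInterval → ℝ) (f : ℝ → ℝ) (x : ℝ) : ℝ :=
  ∑' I : DyadicInterval, σ I * (w x / avg I w) ^ t * ip f (haar I) * haar I x

/-- The constant Haar multiplier `(T_σ T_{w,t}) f = Σ_I (σ_I/⟨w⟩_I^t) ⟨f,h_I⟩ h_I`. -/
def constHaar (w : ℝ → ℝ) (t : ℝ) (σ : DyadicInterval → ℝ) (f : ℝ → ℝ) (x : ℝ) : ℝ :=
  ∑' I : DyadicInterval, σ I / (avg I w) ^ t * ip f (haar I) * haar I x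

/-- The operator `T` maps `L²(u)` into `L²(v)` with norm at most `C`. -/
def BddBy (u v : ℝ → ℝ) (T : (ℝ → ℝ) → ℝ → ℝ) (C : ℝ) : Prop :=
  ∀ f : ℝ → ℝ, Measurable f →
    (∫⁻ x, ENNReal.ofReal ((T f x) ^ 2 * v x)) ≤
      ENNReal.ofReal (C ^ 2) * ∫⁻ x, ENNReal.ofReal ((f x) ^ 2 * u x)

/-- The weight `v w^{2t}`. -/
def vw2t (v w : ℝ → ℝ) (t : ℝ) : ℝ → ℝ := fun x => v x * w x ^ (2 * t)

/-- The coefficient `λ_I = (|Δ_I (v w^{2t})|/⟨v w^{2t}⟩_I)(|Δ_I u⁻¹|/⟨u⁻¹⟩_I)(|I|/⟨w⟩_I^t)`. -/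
def posOpCoef (u v w : ℝ → ℝ) (t : ℝ) (I : DyadicInterval) : ℝ :=
  (|delta I (vw2t v w t)| / avg I (vw2t v w t)) * (|delta I (u⁻¹)| / avg I (u⁻¹)) *
    (I.len / (avg I w) ^ t)

/-- The positive operator `P^t_{w,λ} f = Σ_I (w^t/|I|) λ_I ⟨f⟩_I 1_I`. -/
def posOp (u v w : ℝ → ℝ) (t : ℝ) (f : ℝ → ℝ) (x : ℝ) : ℝ :=
  ∑' I : DyadicInterval, (w x ^ t / I.len) * posOpCoef u v w t I * avg I f *
    I.toSet.indicator (fun _ => (1 : ℝ)) x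

/-- Condition (i): `⟨u⁻¹⟩_I ⟨v w^{2t}⟩_I / ⟨w⟩_I^{2t} ≤ C` for all dyadic `I`. -/
def Cond1 (u v w : ℝ → ℝ) (t C : ℝ) : Prop :=
  ∀ I : DyadicInterval, avg I (u⁻¹) * avg I (vw2t v w t) / (avg I w) ^ (2 * t) ≤ C

/-- Condition (ii): the Carleson condition
`(1/|I|) Σ_{J ⊆ I} |J| |Δ_J u⁻¹|² ⟨v w^{2t}⟩_J / ⟨w⟩_J^{2t} ≤ C ⟨u⁻¹⟩_I`,
phrased via finite partial sums. -/
def Cond2 (u v w : ℝ → ℝ) (t C : ℝ) : Prop :=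
  ∀ I : DyadicInterval, ∀ F : Finset DyadicInterval, (∀ J ∈ F, J.toSet ⊆ I.toSet) →
    I.len⁻¹ * ∑ J ∈ F, J.len * (delta J (u⁻¹)) ^ 2 * avg J (vw2t v w t) / (avg J w) ^ (2 * t)
      ≤ C * avg I (u⁻¹)

/-- Condition (iii): the dual Carleson condition
`(1/|I|) Σ_{J ⊆ I} |J| |Δ_J (v w^{2t})|² ⟨u⁻¹⟩_J / ⟨w⟩_J^{2t} ≤ C ⟨v w^{2t}⟩_I`. -/
def Cond3 (u v w : ℝ → ℝ) (t C : ℝ) : Prop :=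
  ∀ I : DyadicInterval, ∀ F : Finset DyadicInterval, (∀ J ∈ F, J.toSet ⊆ I.toSet) →
    I.len⁻¹ * ∑ J ∈ F, J.len * (delta J (vw2t v w t)) ^ 2 * avg J (u⁻¹) / (avg J w) ^ (2 * t)
      ≤ C * avg I (vw2t v w t)

/-- Uniform (in the signs `σ`) boundedness of the `t`-Haar multipliers from `L²(u)` to `L²(v)`. -/
def UnifBdd (u v w : ℝ → ℝ) (t C : ℝ) : Prop :=
  ∀ σ : DyadicInterval → ℝ, IsSigns σ → BddBy u v (tHaar w t σ) C

/-- `{α_I}` is a `v`-Carleson sequence with intensity `B`: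
`Σ_{J ⊆ I} α_J ≤ B v(I)` for all dyadic `I`, via finite partial sums. -/
def CarlesonSeq (v : ℝ → ℝ) (α : DyadicInterval → ℝ) (B : ℝ) : Prop :=
  ∀ I : DyadicInterval, ∀ F : Finset DyadicInterval, (∀ J ∈ F, J.toSet ⊆ I.toSet) →
    ∑ J ∈ F, α J ≤ B * ∫ x in I.toSet, v x

/-- Dyadic reverse Hölder class `RH_p^d`: `sup_I ⟨w⟩_I^{-1} ⟨w^p⟩_I^{1/p} < ∞`. -/
def MemRHp (w : ℝ → ℝ) (p : ℝ) : Prop :=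
  ∃ C : ℝ, ∀ I : DyadicInterval, (avg I (fun x => w x ^ p)) ^ (1 / p) ≤ C * avg I w

/-- Dyadic Muckenhoupt class `A_p^d`: `sup_I ⟨w⟩_I ⟨w^{-1/(p-1)}⟩_I^{p-1} < ∞`. -/
def MemApd (w : ℝ → ℝ) (p : ℝ) : Prop :=
  ∃ C : ℝ, ∀ I : DyadicInterval,
    avg I w * (avg I (fun x => w x ^ (-1 / (p - 1)))) ^ (p - 1) ≤ C

/-- `RH_1^d` condition with constant `B`: `⟨(v/⟨v⟩_I) log(v/⟨v⟩_I)⟩_I ≤ B` for all dyadic `I`. -/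
def RH1Const (v : ℝ → ℝ) (B : ℝ) : Prop :=
  ∀ I : DyadicInterval,
    avg I (fun x => (v x / avg I v) * Real.log (v x / avg I v)) ≤ B

/-- Dyadic class `RH_1^d`. -/
def MemRH1 (v : ℝ → ℝ) : Prop := ∃ B : ℝ, RH1Const v B

/-- The weighted average `⟨g⟩_I^u = (1/u(I)) ∫_I g u`. -/
def wavg (u : ℝ → ℝ) (I : DyadicInterval) (g : ℝ → ℝ) : ℝ :=
  (∫ x in I.toSet, g x * u x) / ∫ x in I.toSet, u x

/-- The weighted Haar function
`h_I^v = v(I)^{-1/2} ( √(v(I₋)/v(I₊)) 1_{I₊} - √(v(I₊)/v(I₋)) 1_{I₋} )`. -/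
def whaar (v : ℝ → ℝ) (I : DyadicInterval) (x : ℝ) : ℝ :=
  (Real.sqrt (∫ y in I.toSet, v y))⁻¹ *
    (Real.sqrt ((∫ y in I.left.toSet, v y) / ∫ y in I.right.toSet, v y) *
        I.right.toSet.indicator (fun _ => (1 : ℝ)) x -
      Real.sqrt ((∫ y in I.right.toSet, v y) / ∫ y in I.left.toSet, v y) *
        I.left.toSet.indicator (fun _ => (1 : ℝ)) x)

namespace DyadicInterval

lemma len_pos (I : DyadicInterval) : 0 < I.len := zpow_pos two_pos _

lemma mem_toSet_iff (I : DyadicInterval) (x : ℝ) : x ∈ I.toSet ↔ ⌊(2 : ℝ) ^ I.j * x⌋ = I.k := by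
  have h : (0 : ℝ) < 2 ^ I.j := zpow_pos two_pos _
  rw [Int.floor_eq_iff, toSet, Set.mem_Ico, zpow_neg, inv_mul_le_iff₀ h, lt_inv_mul_iff₀ h]

lemma measurableSet_toSet (I : DyadicInterval) : MeasurableSet I.toSet := measurableSet_Ico

lemma volume_toSet (I : DyadicInterval) : volume I.toSet = ENNReal.ofReal I.len := by
  rw [toSet, Real.volume_Ico, len]
  congr 1
  ring

lemma len_left (I : DyadicInterval) : I.left.len = I.len / 2 := by
  simp only [len, left, neg_add, zpow_add₀ (two_ne_zero' ℝ), zpow_neg_one]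
  ring

lemma len_right (I : DyadicInterval) : I.right.len = I.len / 2 := I.len_left

lemma toSet_left (I : DyadicInterval) :
    I.left.toSet = Set.Ico (I.len * I.k) (I.len * I.k + I.len / 2) := by
  have h : (2 : ℝ) ^ (-I.left.j) = I.len / 2 := I.len_left
  rw [toSet, h, left]
  push_cast
  congr 1 <;> ring

lemma toSet_right (I : DyadicInterval) :
    I.right.toSet = Set.Ico (I.len * I.k + I.len / 2) (I.len * (I.k + 1)) := by
  have h : (2 : ℝ) ^ (-I.right.j) = I.len / 2 := I.len_right
  rw [toSet, h, right]
  push_cast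
  congr 1 <;> ring

lemma left_union_right (I : DyadicInterval) : I.left.toSet ∪ I.right.toSet = I.toSet := by
  have h := I.len_pos
  rw [toSet_left, toSet_right, Set.Ico_union_Ico_eq_Ico (by linarith) (by linarith)]
  rfl

lemma disjoint_left_right (I : DyadicInterval) : Disjoint I.left.toSet I.right.toSet := by
  rw [toSet_left, toSet_right]
  exact Set.Ico_disjoint_Ico_same

lemma left_subset (I : DyadicInterval) : I.left.toSet ⊆ I.toSet :=
  I.left_union_right ▸ Set.subset_union_left

lemma right_subset (I : DyadicInterval) : I.right.toSet ⊆ I.toSet :=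
  I.left_union_right ▸ Set.subset_union_right

lemma avg_eq_half_add {I : DyadicInterval} {f : ℝ → ℝ} (hf : IntegrableOn f I.toSet) :
    avg I f = (avg I.left f + avg I.right f) / 2 := by
  have h := I.len_pos.ne'
  simp only [avg, len_left, len_right]
  rw [← I.left_union_right, setIntegral_union I.disjoint_left_right I.right.measurableSet_toSet
    (hf.mono_set I.left_subset) (hf.mono_set I.right_subset)]
  field_simp

lemma avg_pos {I : DyadicInterval} {f : ℝ → ℝ} (hf : IntegrableOn f I.toSet)
    (hpos : ∀ᵐ x, 0 < f x) : 0 < avg I f := by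
  refine mul_pos (inv_pos.2 I.len_pos) ?_
  rw [setIntegral_pos_iff_support_of_nonneg_ae
    (ae_restrict_of_ae (hpos.mono fun x hx => hx.le)) hf]
  have h : (Function.support f ∩ I.toSet : Set ℝ) =ᵐ[volume] I.toSet := by
    filter_upwards [hpos] with x hx
    exact propext ⟨fun h => h.2, fun h => ⟨hx.ne', h⟩⟩
  rw [measure_congr h, volume_toSet]
  exact ENNReal.ofReal_pos.2 I.len_pos

/-- The dyadic interval of length `2^{-m}` that contains `x`. -/
def cell (m : ℤ) (x : ℝ) : DyadicInterval := ⟨m, ⌊(2 : ℝ) ^ m * x⌋⟩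

lemma mem_cell (m : ℤ) (x : ℝ) : x ∈ (cell m x).toSet := (mem_toSet_iff _ _).2 rfl

lemma cell_eq {I : DyadicInterval} {x : ℝ} (hx : x ∈ I.toSet) : cell I.j x = I := by
  rw [cell, (I.mem_toSet_iff x).1 hx]

lemma cell_subset (n : ℕ) : ∀ {I : DyadicInterval} {x : ℝ}, x ∈ I.toSet →
    (cell (I.j + n) x).toSet ⊆ I.toSet := by
  induction n with
  | zero => intro I x hx; simp [cell_eq hx]
  | succ n ih =>
    intro I x hx
    have hj : I.j + ((n + 1 : ℕ) : ℤ) = I.j + 1 + n := by push_cast; ring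
    rw [hj]
    rcases I.left_union_right.symm ▸ hx with h | h
    · exact (ih h).trans I.left_subset
    · exact (ih h).trans I.right_subset

lemma avg_eq_setAverage (I : DyadicInterval) (f : ℝ → ℝ) :
    avg I f = ⨍ y in Metric.closedBall (I.len * I.k + I.len / 2) (I.len / 2), f y := by
  have h : Metric.closedBall (I.len * I.k + I.len / 2) (I.len / 2) =ᵐ[volume] I.toSet := by
    have hl : I.len * I.k + I.len / 2 - I.len / 2 = I.len * I.k := by ring
    have hr : I.len * I.k + I.len / 2 + I.len / 2 = I.len * (I.k + 1) := by ring
    rw [Real.closedBall_eq_Icc, hl, hr]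
    exact Ico_ae_eq_Icc.symm
  rw [setAverage_congr h, setAverage_eq, Measure.real, volume_toSet,
    ENNReal.toReal_ofReal I.len_pos.le, avg, smul_eq_mul]

/-- Lebesgue differentiation along dyadic intervals. -/
lemma ae_tendsto_avg_cell {I : DyadicInterval} {f : ℝ → ℝ} (hf : IntegrableOn f I.toSet) :
    ∀ᵐ x ∂volume.restrict I.toSet,
      Filter.Tendsto (fun n : ℕ => avg (cell (I.j + n) x) f) Filter.atTop (nhds (f x)) := by
  have hint : Integrable (I.toSet.indicator f) :=
    (integrable_indicator_iff I.measurableSet_toSet).2 hf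
  rw [ae_restrict_iff' I.measurableSet_toSet]
  filter_upwards [IsUnifLocDoublingMeasure.ae_tendsto_average volume hint.locallyIntegrable 1]
    with x hx hxI
  have hlen (n : ℕ) : (cell (I.j + n) x).len / 2 = I.len / 2 * (1 / 2) ^ n := by
    simp only [len, cell, neg_add, zpow_add₀ (two_ne_zero' ℝ), zpow_neg, zpow_natCast]
    rw [one_div, inv_pow]
    ring
  have hlim := hx (l := Filter.atTop)
    (fun n : ℕ => (cell (I.j + n) x).len * (cell (I.j + n) x).k + (cell (I.j + n) x).len / 2)
    (fun n : ℕ => (cell (I.j + n) x).len / 2) ?_ ?_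
  · rw [Set.indicator_of_mem hxI] at hlim
    refine hlim.congr fun n => ?_
    rw [← avg_eq_setAverage, avg, avg, setIntegral_indicator I.measurableSet_toSet,
      Set.inter_eq_left.2 (cell_subset n hxI)]
  · refine tendsto_nhdsWithin_iff.2 ⟨?_, Filter.Eventually.of_forall fun n => half_pos (len_pos _)⟩
    simp only [hlen]
    simpa using (tendsto_pow_atTop_nhds_zero_of_lt_one (r := (1 / 2 : ℝ)) (by norm_num)
      (by norm_num)).const_mul (I.len / 2)
  · refine Filter.Eventually.of_forall fun n => ?_
    have h := mem_cell (I.j + n) x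
    rw [toSet, ← len, Set.mem_Ico] at h
    rw [one_mul, Real.closedBall_eq_Icc, Set.mem_Icc]
    constructor <;> linarith [h.1, h.2]

lemma measurable_cell_comp {α : Type*} [MeasurableSpace α] (m : ℤ) (g : DyadicInterval → α) :
    Measurable fun x => g (cell m x) :=
  (measurable_of_countable fun k : ℤ => g ⟨m, k⟩).comp
    (Int.measurable_floor.comp (measurable_const_mul _))

end DyadicInterval

lemma add_half_mul_log_div_le {y₁ y₂ c : ℝ} (h₁ : 0 < y₁) (h₂ : 0 < y₂) (hc : 0 < c) :
    (y₁ * Real.log (y₁ / c) + y₂ * Real.log (y₂ / c)) / 2 ≤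
      (y₁ + y₂) / 2 * Real.log ((y₁ + y₂) / 2 / c)
        + ((y₁ - y₂) / 2) ^ 2 / ((y₁ + y₂) / 2) := by
  set y := (y₁ + y₂) / 2 with hy
  have hy0 : 0 < y := by positivity
  have key {z : ℝ} (hz : 0 < z) : z * Real.log (z / c) ≤ z * (Real.log (y / c) + (z / y - 1)) := by
    refine mul_le_mul_of_nonneg_left ?_ hz.le
    have h : z / c = y / c * (z / y) := by field_simp
    rw [h, Real.log_mul (by positivity) (by positivity)]
    gcongr
    exact Real.log_le_sub_one_of_pos (by positivity)
  calc _ ≤ (y₁ * (Real.log (y / c) + (y₁ / y - 1))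
          + y₂ * (Real.log (y / c) + (y₂ / y - 1))) / 2 := by
        linarith [key h₁, key h₂]
    _ = _ := by
        have h : y₂ = 2 * y - y₁ := by linarith
        rw [h]
        field_simp
        ring

/-- Quantitative midpoint convexity of `(x, y) ↦ 1 / (x ^ (2 s) y)`. -/
lemma inv_rpow_sq_mul_midpoint {s x₁ x₂ y₁ y₂ : ℝ} (hs : 0 ≤ s) (hx₁ : 0 < x₁) (hx₂ : 0 < x₂)
    (hy₁ : 0 < y₁) (hy₂ : 0 < y₂) :
    ((((x₁ + x₂) / 2) ^ s) ^ 2 * ((y₁ + y₂) / 2))⁻¹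
        * (1 + ((y₁ - y₂) / 2) ^ 2 / (2 * ((y₁ + y₂) / 2) ^ 2)) ≤
      (((x₁ ^ s) ^ 2 * y₁)⁻¹ + ((x₂ ^ s) ^ 2 * y₂)⁻¹) / 2 := by
  have ha₁ : 0 < x₁ ^ s := Real.rpow_pos_of_pos hx₁ s
  have ha₂ : 0 < x₂ ^ s := Real.rpow_pos_of_pos hx₂ s
  have ha : 0 < ((x₁ + x₂) / 2) ^ s := Real.rpow_pos_of_pos (by positivity) s
  have hmul : x₁ ^ s * x₂ ^ s ≤ (((x₁ + x₂) / 2) ^ s) ^ 2 := by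
    rw [sq, ← Real.mul_rpow hx₁.le hx₂.le, ← Real.mul_rpow (by positivity) (by positivity)]
    exact Real.rpow_le_rpow (by positivity) (by nlinarith [sq_nonneg (x₁ - x₂)]) hs
  generalize ((x₁ + x₂) / 2) ^ s = a at *
  generalize x₁ ^ s = a₁ at *
  generalize x₂ ^ s = a₂ at *
  obtain ⟨r₁, hr₁, rfl⟩ : ∃ r, 0 < r ∧ r ^ 2 = y₁ := ⟨√y₁, by positivity, Real.sq_sqrt hy₁.le⟩
  obtain ⟨r₂, hr₂, rfl⟩ : ∃ r, 0 < r ∧ r ^ 2 = y₂ := ⟨√y₂, by positivity, Real.sq_sqrt hy₂.le⟩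
  set y := (r₁ ^ 2 + r₂ ^ 2) / 2 with hy
  set d := (r₁ ^ 2 - r₂ ^ 2) / 2 with hd
  have hy0 : 0 < y := by positivity
  have hr : (r₁ * r₂) ^ 2 = y ^ 2 - d ^ 2 := by rw [hy, hd]; ring
  have hgeom : y⁻¹ * (1 + d ^ 2 / (2 * y ^ 2)) ≤ (r₁ * r₂)⁻¹ := by
    have h1 : r₁ * r₂ ≤ y - d ^ 2 / (2 * y) := by
      have h : y - d ^ 2 / (2 * y) = (y ^ 2 + (r₁ * r₂) ^ 2) / (2 * y) := by
        rw [hr]; field_simp; ring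
      rw [h, le_div_iff₀ (by positivity)]
      nlinarith [sq_nonneg (y - r₁ * r₂)]
    rw [le_inv_comm₀ (by positivity) (by positivity)]
    refine h1.trans ?_
    rw [mul_inv, inv_inv, ← div_eq_mul_inv, le_div_iff₀ (by positivity)]
    have h : (y - d ^ 2 / (2 * y)) * (1 + d ^ 2 / (2 * y ^ 2)) = y - d ^ 4 / (4 * y ^ 3) := by
      field_simp; ring
    rw [h]
    have : 0 ≤ d ^ 4 / (4 * y ^ 3) := by positivity
    linarith
  calc (a ^ 2 * y)⁻¹ * (1 + d ^ 2 / (2 * y ^ 2))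
      = (a ^ 2)⁻¹ * (y⁻¹ * (1 + d ^ 2 / (2 * y ^ 2))) := by rw [mul_inv]; ring
    _ ≤ (a₁ * a₂)⁻¹ * (r₁ * r₂)⁻¹ := by gcongr
    _ = (a₁ * r₁)⁻¹ * (a₂ * r₂)⁻¹ := by simp only [mul_inv]; ring
    _ ≤ (((a₁ * r₁)⁻¹) ^ 2 + ((a₂ * r₂)⁻¹) ^ 2) / 2 := by
        nlinarith [sq_nonneg ((a₁ * r₁)⁻¹ - (a₂ * r₂)⁻¹)]
    _ = _ := by simp only [inv_pow, mul_pow]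

/-- The midpoint concavity of `y log (y / c) - 2 D² / (x ^ (2 s) y)` where `x ^ s y ≤ D`. -/
lemma bellman_midpoint {s x₁ x₂ y₁ y₂ c D : ℝ} (hs : 0 ≤ s) (hx₁ : 0 < x₁) (hx₂ : 0 < x₂)
    (hy₁ : 0 < y₁) (hy₂ : 0 < y₂) (hc : 0 < c)
    (hD : ((x₁ + x₂) / 2) ^ s * ((y₁ + y₂) / 2) ≤ D) :
    (y₁ * Real.log (y₁ / c) - 2 * D ^ 2 * ((x₁ ^ s) ^ 2 * y₁)⁻¹
        + (y₂ * Real.log (y₂ / c) - 2 * D ^ 2 * ((x₂ ^ s) ^ 2 * y₂)⁻¹)) / 2 ≤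
      (y₁ + y₂) / 2 * Real.log ((y₁ + y₂) / 2 / c)
        - 2 * D ^ 2 * ((((x₁ + x₂) / 2) ^ s) ^ 2 * ((y₁ + y₂) / 2))⁻¹ := by
  have h1 := add_half_mul_log_div_le hy₁ hy₂ hc
  have h2 := mul_le_mul_of_nonneg_left (inv_rpow_sq_mul_midpoint hs hx₁ hx₂ hy₁ hy₂)
    (by positivity : 0 ≤ 2 * D ^ 2)
  have ha : 0 < ((x₁ + x₂) / 2) ^ s := Real.rpow_pos_of_pos (by positivity) s
  have hy : 0 < (y₁ + y₂) / 2 := by positivity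
  generalize ((x₁ + x₂) / 2) ^ s = a at *
  generalize (y₁ + y₂) / 2 = y at *
  generalize (y₁ - y₂) / 2 = d at *
  have h3 : d ^ 2 / y ≤ 2 * D ^ 2 * ((a ^ 2 * y)⁻¹ * (d ^ 2 / (2 * y ^ 2))) := by
    have h : 2 * D ^ 2 * ((a ^ 2 * y)⁻¹ * (d ^ 2 / (2 * y ^ 2))) =
        d ^ 2 / y * (D ^ 2 / (a * y) ^ 2) := by field_simp
    rw [h]
    refine le_mul_of_one_le_right (by positivity) ?_
    rw [one_le_div (by positivity)]
    gcongr
  linarith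

lemma mul_log_div_add_nonneg {y c : ℝ} (hc : 0 < c) (hy : 0 < y) :
    0 ≤ y * Real.log (y / c) + c := by
  have h := Real.one_sub_inv_le_log_of_pos (div_pos hy hc)
  have h2 := mul_le_mul_of_nonneg_left h hy.le
  have h3 : y * (1 - (y / c)⁻¹) = y - c := by field_simp
  linarith

/-- The entropy of the averages over the `n`-th generation is controlled by the Bellman function. -/
lemma lintegral_avg_cell_le {w v : ℝ → ℝ} {s c D : ℝ} (hs : 0 ≤ s) (hc : 0 < c)
    (hw : LocallyIntegrable w) (hw0 : ∀ᵐ x, 0 < w x) (hv0 : ∀ᵐ x, 0 < v x) (n : ℕ) :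
    ∀ I : DyadicInterval, IntegrableOn v I.toSet →
      (∀ J : DyadicInterval, J.toSet ⊆ I.toSet →
        1 ≤ avg J w ^ s * avg J v ∧ avg J w ^ s * avg J v ≤ D) →
      ∫⁻ x in I.toSet, ENNReal.ofReal
          (avg (cell (I.j + n) x) v * Real.log (avg (cell (I.j + n) x) v / c) + c) ≤
        ENNReal.ofReal (I.len * (avg I v * Real.log (avg I v / c) + c
          + 2 * D ^ 2 * (avg I v - ((avg I w ^ s) ^ 2 * avg I v)⁻¹))) := by
  have hwI (I : DyadicInterval) : IntegrableOn w I.toSet :=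
    (hw.integrableOn_isCompact isCompact_Icc).mono_set Set.Ico_subset_Icc_self
  have hH (I : DyadicInterval) (hvI : IntegrableOn v I.toSet) (h1 : 1 ≤ avg I w ^ s * avg I v) :
      0 ≤ 2 * D ^ 2 * (avg I v - ((avg I w ^ s) ^ 2 * avg I v)⁻¹) := by
    have hy := avg_pos hvI hv0
    have ha : 0 < avg I w ^ s := Real.rpow_pos_of_pos (avg_pos (hwI I) hw0) s
    refine mul_nonneg (by positivity) (sub_nonneg.2 ?_)
    rw [inv_le_iff_one_le_mul₀ (by positivity)]
    nlinarith
  induction n with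
  | zero =>
    intro I hvI hI
    have hconst : ∫⁻ x in I.toSet, ENNReal.ofReal (avg (cell (I.j + (0 : ℕ)) x) v
          * Real.log (avg (cell (I.j + (0 : ℕ)) x) v / c) + c) =
        ∫⁻ _ in I.toSet, ENNReal.ofReal (avg I v * Real.log (avg I v / c) + c) := by
      refine setLIntegral_congr_fun I.measurableSet_toSet fun x hx => ?_
      simp only [Nat.cast_zero, add_zero, cell_eq hx]
    rw [hconst, setLIntegral_const, volume_toSet, mul_comm, ← ENNReal.ofReal_mul I.len_pos.le]
    refine ENNReal.ofReal_le_ofReal (mul_le_mul_of_nonneg_left ?_ I.len_pos.le)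
    linarith [hH I hvI (hI I subset_rfl).1]
  | succ n ih =>
    intro I hvI hI
    have hvl := hvI.mono_set I.left_subset
    have hvr := hvI.mono_set I.right_subset
    have hl := ih I.left hvl fun J hJ => hI J (hJ.trans I.left_subset)
    have hr := ih I.right hvr fun J hJ => hI J (hJ.trans I.right_subset)
    have hj : I.j + ((n + 1 : ℕ) : ℤ) = I.j + 1 + n := by push_cast; ring
    have hnn (J : DyadicInterval) (hvJ : IntegrableOn v J.toSet) (hJ : J.toSet ⊆ I.toSet) :
        0 ≤ J.len * (avg J v * Real.log (avg J v / c) + c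
          + 2 * D ^ 2 * (avg J v - ((avg J w ^ s) ^ 2 * avg J v)⁻¹)) :=
      mul_nonneg J.len_pos.le (add_nonneg (mul_log_div_add_nonneg hc (avg_pos hvJ hv0))
        (hH J hvJ (hI J hJ).1))
    have hB := bellman_midpoint (c := c) (D := D) hs
      (avg_pos (hwI I.left) hw0) (avg_pos (hwI I.right) hw0) (avg_pos hvl hv0) (avg_pos hvr hv0) hc
      (by rw [← avg_eq_half_add (hwI I), ← avg_eq_half_add hvI]; exact (hI I subset_rfl).2)
    rw [← avg_eq_half_add (hwI I), ← avg_eq_half_add hvI] at hB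
    have hy := avg_eq_half_add hvI
    rw [hj]
    nth_rw 1 [← I.left_union_right]
    rw [lintegral_union I.right.measurableSet_toSet I.disjoint_left_right]
    refine (add_le_add hl hr).trans ?_
    rw [← ENNReal.ofReal_add (hnn _ hvl I.left_subset) (hnn _ hvr I.right_subset), len_left,
      len_right]
    refine ENNReal.ofReal_le_ofReal ?_
    have hB' := mul_le_mul_of_nonneg_left hB I.len_pos.le
    linear_combination hB' - 2 * D ^ 2 * I.len * hy

/-- A pair of weights with `1 ≤ ⟨w⟩_J^s ⟨v⟩_J ≤ D` on the dyadic subintervals of `I` obeys an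
entropy bound on `I`. -/
lemma avg_entropy_le {w v : ℝ → ℝ} {s D : ℝ} (hs : 0 ≤ s)
    (hw : LocallyIntegrable w) (hw0 : ∀ᵐ x, 0 < w x) (hv0 : ∀ᵐ x, 0 < v x) (I : DyadicInterval)
    (hvI : IntegrableOn v I.toSet)
    (hI : ∀ J : DyadicInterval, J.toSet ⊆ I.toSet →
      1 ≤ avg J w ^ s * avg J v ∧ avg J w ^ s * avg J v ≤ D) :
    avg I (fun x => v x / avg I v * Real.log (v x / avg I v)) ≤ 2 * D ^ 2 := by
  set c := avg I v with hcdef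
  have hc : 0 < c := avg_pos hvI hv0
  have hlen := I.len_pos
  have hlint : ∫⁻ x in I.toSet, ENNReal.ofReal (v x * Real.log (v x / c) + c) ≤
      ENNReal.ofReal (I.len * (c + 2 * D ^ 2 * c)) := by
    have hcont : Continuous fun u : ℝ => ENNReal.ofReal (u * Real.log (u / c) + c) := by
      have h : (fun u : ℝ => u * Real.log (u / c)) = fun u => c * (u / c * Real.log (u / c)) := by
        ext u; field_simp
      have h2 : Continuous fun u : ℝ => u * Real.log (u / c) := by
        rw [h]
        exact (Real.continuous_mul_log.comp (continuous_id.div_const c)).const_mul c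
      exact ENNReal.continuous_ofReal.comp (h2.add_const c)
    calc _ = ∫⁻ x in I.toSet, Filter.liminf (fun n : ℕ => ENNReal.ofReal
            (avg (cell (I.j + n) x) v * Real.log (avg (cell (I.j + n) x) v / c) + c))
            Filter.atTop := by
          refine lintegral_congr_ae ?_
          filter_upwards [ae_tendsto_avg_cell hvI] with x hx
          exact ((hcont.tendsto (v x)).comp hx).liminf_eq.symm
      _ ≤ Filter.liminf (fun n : ℕ => ∫⁻ x in I.toSet, ENNReal.ofReal
            (avg (cell (I.j + n) x) v * Real.log (avg (cell (I.j + n) x) v / c) + c))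
            Filter.atTop :=
          lintegral_liminf_le fun n => measurable_cell_comp (I.j + n)
            fun J => ENNReal.ofReal (avg J v * Real.log (avg J v / c) + c)
      _ ≤ _ := by
          refine Filter.liminf_le_of_le (by isBoundedDefault) fun b hb => ?_
          obtain ⟨n, hn⟩ := hb.exists
          refine (hn.trans (lintegral_avg_cell_le hs hc hw hw0 hv0 n I hvI hI)).trans
            (ENNReal.ofReal_le_ofReal (mul_le_mul_of_nonneg_left ?_ hlen.le))
          rw [← hcdef, div_self hc.ne', Real.log_one, mul_zero, zero_add]
          have h : 0 ≤ ((avg I w ^ s) ^ 2 * c)⁻¹ := by positivity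
          nlinarith [mul_nonneg (sq_nonneg D) h]
  by_cases hint : IntegrableOn (fun x => v x / c * Real.log (v x / c)) I.toSet
  · have hfun : (fun x => v x * Real.log (v x / c) + c) =
        fun x => c * (v x / c * Real.log (v x / c)) + c := by
      ext x; field_simp
    have hconst : IntegrableOn (fun _ : ℝ => c) I.toSet :=
      integrableOn_const (by rw [volume_toSet]; exact ENNReal.ofReal_ne_top)
    have hint' : IntegrableOn (fun x => v x * Real.log (v x / c) + c) I.toSet := by
      rw [hfun]
      exact (Integrable.const_mul hint c).add hconst
    rw [← ofReal_integral_eq_lintegral_ofReal hint' (ae_restrict_of_ae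
      (hv0.mono fun x hx => mul_log_div_add_nonneg hc hx)),
      ENNReal.ofReal_le_ofReal_iff (by positivity), hfun,
      integral_add (Integrable.const_mul hint c) hconst, integral_const_mul, setIntegral_const,
      Measure.real, volume_toSet, ENNReal.toReal_ofReal hlen.le, smul_eq_mul] at hlint
    rw [avg, inv_mul_le_iff₀ hlen]
    refine le_of_mul_le_mul_left ?_ hc
    linarith
  · rw [avg, integral_undef hint, mul_zero]
    positivity

lemma one_le_avg_rpow_mul_avg {w : ℝ → ℝ} {s : ℝ} (hs : 0 ≤ s) {J : DyadicInterval}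
    (hw0 : ∀ᵐ x, 0 < w x) (hw : IntegrableOn w J.toSet)
    (hv : IntegrableOn (fun x => w x ^ (-s)) J.toSet) :
    1 ≤ avg J w ^ s * avg J (fun x => w x ^ (-s)) := by
  have hm := avg_pos hw hw0
  have hlen := J.len_pos
  set m := avg J w with hmdef
  have hms : 0 < m ^ s := Real.rpow_pos_of_pos hm s
  have hconst (b : ℝ) : IntegrableOn (fun _ : ℝ => b) J.toSet :=
    integrableOn_const (by rw [volume_toSet]; exact ENNReal.ofReal_ne_top)
  have hpt : ∀ᵐ x, (1 + s) + -(s / m) * w x ≤ m ^ s * w x ^ (-s) := by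
    filter_upwards [hw0] with x hx
    have h1 : m ^ s * w x ^ (-s) = Real.exp (-s * Real.log (w x / m)) := by
      rw [Real.rpow_def_of_pos hm, Real.rpow_def_of_pos hx, ← Real.exp_add,
        Real.log_div hx.ne' hm.ne']
      ring_nf
    have h2 := Real.add_one_le_exp (-s * Real.log (w x / m))
    have h3 := mul_le_mul_of_nonneg_left (Real.log_le_sub_one_of_pos (div_pos hx hm)) hs
    have h4 : s / m * w x = s * (w x / m) := by ring
    rw [h1]
    linarith
  have hle := integral_mono_ae (μ := volume.restrict J.toSet)
    ((hconst (1 + s)).add (Integrable.const_mul hw (-(s / m)))) (Integrable.const_mul hv (m ^ s))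
    (ae_restrict_of_ae hpt)
  have hwint : ∫ x in J.toSet, w x = J.len * m := by rw [hmdef, avg]; field_simp
  simp only [Pi.add_apply] at hle
  rw [integral_add (hconst _) (Integrable.const_mul hw _), integral_const_mul, integral_const_mul,
    setIntegral_const, Measure.real, volume_toSet, ENNReal.toReal_ofReal hlen.le, smul_eq_mul,
    hwint] at hle
  have h : J.len * (1 + s) + -(s / m) * (J.len * m) = J.len := by field_simp; ring
  rw [h] at hle
  rw [avg, mul_left_comm, ← div_eq_inv_mul, one_le_div hlen]
  exact hle

/-- If `w ∈ A_p^d` (`1 < p < ∞`) then its dual weight `w^{-1/(p-1)}` belongs to `RH_1^d`. -/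
theorem Apd_dual_mem_RH1 (p : ℝ) (hp : 1 < p) (w : ℝ → ℝ) (hw : IsWeight w)
    (hAp : MemApd w p) :
    MemRH1 (fun x => w x ^ (-1 / (p - 1))) := by
  obtain ⟨hw0, hwloc⟩ := hw
  obtain ⟨C, hC⟩ := hAp
  have hp1 : 0 < p - 1 := sub_pos.2 hp
  have hs : 0 ≤ 1 / (p - 1) := by positivity
  have hexp : -1 / (p - 1) = -(1 / (p - 1)) := neg_div _ _
  rw [hexp] at hC ⊢
  have hv0 : ∀ᵐ x, 0 < w x ^ (-(1 / (p - 1))) := hw0.mono fun x hx => Real.rpow_pos_of_pos hx _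
  refine ⟨2 * (C ^ (1 / (p - 1))) ^ 2, fun I => ?_⟩
  by_cases hvI : IntegrableOn (fun x => w x ^ (-(1 / (p - 1)))) I.toSet
  · refine avg_entropy_le hs hwloc hw0 hv0 I hvI fun J hJ => ?_
    have hwJ : IntegrableOn w J.toSet :=
      (hwloc.integrableOn_isCompact isCompact_Icc).mono_set Set.Ico_subset_Icc_self
    have hvJ := hvI.mono_set hJ
    refine ⟨one_le_avg_rpow_mul_avg hs hw0 hwJ hvJ, ?_⟩
    have hx := avg_pos hwJ hw0
    have hy := avg_pos hvJ hv0
    have h := Real.rpow_le_rpow (by positivity) (hC J) hs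
    rwa [Real.mul_rpow hx.le (by positivity), ← Real.rpow_mul hy.le, mul_one_div_cancel hp1.ne',
      Real.rpow_one] at h
  · have h0 : avg I (fun x => w x ^ (-(1 / (p - 1)))) = 0 := by
      rw [avg, integral_undef hvI, mul_zero]
    simp only [h0, div_zero, Real.log_zero, mul_zero]
    rw [avg, integral_zero, mul_zero]
    positivity
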